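/- (Guarantee for the passive estimator WIDEHIST, k = 1.) Fix c ∈ (0, 1/4]. There exist constants κ > 0 and n₀ ≥ 1, depending only on c, such that for every integer n ≥ n₀, every σ ∈ (0, 1/2], and every δ ∈ (0, 1) for which h := κ √((σ/n)·log(2n/δ)) satisfies h ≤ σ, there exists a measurable estimator t̂ : {0,1}^n → ℝ (depending only on n, σ, δ and c) with the following property: for every t ∈ [−1/2, 1/2], if Y₁, …, Y_n are independent with Y_j distributed Bernoulli(F_t(w_j)) at the equally spaced design points w_j = −1 + (2j−1)/n, then P( |t̂(Y₁, …, Y_n) − t| > 2h ) ≤ δ. -/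

import Mathlib

open MeasureTheory Real
open scoped ENNReal

/-- Uniform-noise convolution: `(g ⋆ U_σ)(w) = (1/(2σ)) ∫_{w-σ}^{w+σ} g(x) dx`. -/
noncomputable def unifConv (σ : ℝ) (g : ℝ → ℝ) (w : ℝ) : ℝ :=
  (1 / (2 * σ)) * ∫ x in (w - σ)..(w + σ), g x

/-- Step regression function with threshold `t` and jump size `c`. -/
noncomputable def stepFn (c t : ℝ) (x : ℝ) : ℝ :=
  if x < t then 1 / 2 - c else 1 / 2 + c

/-- The Bernoulli measure with parameter `p` on `Bool`. -/
noncomputable def bern (p : ℝ) : Measure Bool :=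
  ENNReal.ofReal p • Measure.dirac true + ENNReal.ofReal (1 - p) • Measure.dirac false

theorem unifConv_stepFn {σ : ℝ} (hσ : 0 < σ) (c t w : ℝ) :
    unifConv σ (stepFn c t) w =
      1 / 2 + c / σ * (w - max (w - σ) (min t (w + σ))) := by
  set m := max (w - σ) (min t (w + σ)) with hm
  have ham : w - σ ≤ m := le_max_left _ _
  have hmb : m ≤ w + σ := max_le (by linarith) (min_le_right _ _)
  have left : Set.EqOn (fun _ ↦ 1 / 2 - c) (stepFn c t) (Set.uIoo (w - σ) m) := by
    rw [Set.uIoo_of_le ham]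
    rintro x ⟨hx, hxm⟩
    have : x < min t (w + σ) := (lt_max_iff.1 hxm).resolve_left hx.not_gt
    simp [stepFn, this.trans_le (min_le_left _ _)]
  have right : Set.EqOn (fun _ ↦ 1 / 2 + c) (stepFn c t) (Set.uIoo m (w + σ)) := by
    rw [Set.uIoo_of_le hmb]
    rintro x ⟨hmx, hx⟩
    have : min t (w + σ) < x := (le_max_right _ _).trans_lt hmx
    have : t < x := (min_lt_iff.1 this).resolve_right hx.not_gt
    simp [stepFn, this.le]
  rw [unifConv, ← intervalIntegral.integral_add_adjacent_intervals
    (intervalIntegrable_const.congr_uIoo left) (intervalIntegrable_const.congr_uIoo right),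
    ← intervalIntegral.integral_congr_uIoo left, ← intervalIntegral.integral_congr_uIoo right,
    intervalIntegral.integral_const, intervalIntegral.integral_const]
  simp only [smul_eq_mul]
  field_simp
  ring

theorem unifConv_stepFn_mem_Icc {σ c : ℝ} (hσ : 0 < σ) (hc : 0 ≤ c) (hc' : c ≤ 1 / 2) (t w : ℝ) :
    unifConv σ (stepFn c t) w ∈ Set.Icc (0 : ℝ) 1 := by
  rw [unifConv_stepFn hσ]
  set m := max (w - σ) (min t (w + σ)) with hm
  have ham : w - σ ≤ m := le_max_left _ _
  have hmb : m ≤ w + σ := max_le (by linarith) (min_le_right _ _)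
  have hcσ : 0 ≤ c / σ := by positivity
  have hmul : c / σ * σ = c := by field_simp
  constructor <;> nlinarith

/-- Moving the threshold from `a` up to `b` lowers the smoothed step by at least `c h / σ` on
`[b - σ, b]`. -/
theorem unifConv_stepFn_gap {σ c h a b w : ℝ} (hσ : 0 < σ) (hc : 0 ≤ c) (hh : h ≤ σ)
    (hab : h ≤ b - a) (hw : b - σ ≤ w) (hw' : w ≤ b) :
    c / σ * h ≤ unifConv σ (stepFn c a) w - unifConv σ (stepFn c b) w := by
  rw [unifConv_stepFn hσ, unifConv_stepFn hσ, min_eq_left (by linarith : b ≤ w + σ),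
    max_eq_right (by linarith : w - σ ≤ b)]
  have hm : max (w - σ) (min a (w + σ)) ≤ b - h :=
    max_le (by linarith) ((min_le_left _ _).trans (by linarith))
  have hcσ : 0 ≤ c / σ := by positivity
  nlinarith

theorem isProbabilityMeasure_bern {p : ℝ} (hp : p ∈ Set.Icc (0 : ℝ) 1) :
    IsProbabilityMeasure (bern p) := by
  constructor
  simp [bern, ← ENNReal.ofReal_add hp.1 (sub_nonneg.2 hp.2)]

theorem integral_bern {p : ℝ} (hp : p ∈ Set.Icc (0 : ℝ) 1) :
    ∫ b, (if b then (1 : ℝ) else 0) ∂bern p = p := by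
  rw [bern, integral_add_measure (Integrable.of_finite.smul_measure ENNReal.ofReal_ne_top)
    (Integrable.of_finite.smul_measure ENNReal.ofReal_ne_top), integral_smul_measure,
    integral_smul_measure]
  simp [hp.1]

/-- Hoeffding's inequality for a sum of independent Bernoulli variables over `W`. -/
theorem bern_pi_sum_deviation_le {ι : Type*} [Fintype ι] {p : ι → ℝ}
    (hp : ∀ i, p i ∈ Set.Icc (0 : ℝ) 1) (W : Finset ι) {L : ℝ} (hL : 0 ≤ L) :
    Measure.pi (fun i ↦ bern (p i))
      {y | √(W.card * L / 2) < |∑ i ∈ W, ((if y i then (1 : ℝ) else 0) - p i)|} ≤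
      ENNReal.ofReal (2 * exp (-L)) := by
  rcases W.eq_empty_or_nonempty with rfl | hW
  · simp
  have := fun i ↦ isProbabilityMeasure_bern (hp i)
  set μ := Measure.pi fun i ↦ bern (p i)
  set X : ι → (ι → Bool) → ℝ := fun i y ↦ (if y i then (1 : ℝ) else 0) - p i with hX
  set τ := √(W.card * L / 2) with hτ
  have hindep : ProbabilityTheory.iIndepFun X μ :=
    ProbabilityTheory.iIndepFun_pi (μ := fun i ↦ bern (p i))
      (X := fun i b ↦ (if b then (1 : ℝ) else 0) - p i)
      fun i ↦ (measurable_of_finite _).aemeasurable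
  have hsub (i : ι) : ProbabilityTheory.HasSubgaussianMGF (X i) ((‖(1 : ℝ) - 0‖₊ / 2) ^ 2) μ := by
    have hmean : ∫ y, (if y i then (1 : ℝ) else 0) ∂μ = p i := by
      rw [integral_comp_eval (μ := fun i ↦ bern (p i)) (f := fun b ↦ if b then (1 : ℝ) else 0)
        (measurable_of_finite _).aestronglyMeasurable, integral_bern (hp i)]
    have := ProbabilityTheory.hasSubgaussianMGF_of_mem_Icc (μ := μ) (a := 0) (b := 1)
      (X := fun y ↦ if y i then (1 : ℝ) else 0) (measurable_of_finite _).aemeasurable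
      (ae_of_all _ fun y ↦ by split_ifs <;> simp)
    rwa [hmean] at this
  have hcard : (0 : ℝ) < W.card := by exact_mod_cast hW.card_pos
  have hexp : -τ ^ 2 / (2 * ((∑ _i ∈ W, (‖(1 : ℝ) - 0‖₊ / 2) ^ 2 : NNReal) : ℝ)) = -L := by
    rw [hτ, sq_sqrt (by positivity)]
    simp
    field_simp
  have hupper := ProbabilityTheory.HasSubgaussianMGF.measure_sum_ge_le_of_iIndepFun hindep
    (s := W) (fun i _ ↦ hsub i) (sqrt_nonneg (W.card * L / 2))
  have hlower := ProbabilityTheory.HasSubgaussianMGF.measure_sum_ge_le_of_iIndepFun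
    (hindep.comp (fun _ x ↦ -x) fun _ ↦ measurable_neg)
    (s := W) (fun i _ ↦ (hsub i).neg) (sqrt_nonneg (W.card * L / 2))
  rw [← hτ] at hupper hlower
  push_cast at hupper hlower hexp
  rw [hexp] at hupper hlower
  rw [← ofReal_measureReal]
  refine ENNReal.ofReal_le_ofReal ?_
  calc μ.real {y | τ < |∑ i ∈ W, X i y|}
      ≤ μ.real ({y | τ ≤ ∑ i ∈ W, X i y} ∪
          {y | τ ≤ ∑ i ∈ W, ((fun x ↦ -x) ∘ X i) y}) := by
        refine measureReal_mono fun y hy ↦ ?_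
        simp only [Function.comp_apply, Finset.sum_neg_distrib, Set.mem_union, Set.mem_ofPred_eq]
        exact le_abs.1 (le_of_lt hy)
    _ ≤ _ := measureReal_union_le _ _
    _ ≤ 2 * exp (-L) := by linarith

/-- An interval `[b - σ, b]` of `[-1, 1/2]` contains `m` consecutive points of the grid
`-1 + (2 j + 1) / n`, provided `m` is at most about half of the expected number. -/
theorem exists_grid_window {n m : ℕ} {σ b : ℝ} (hmσ : (m : ℝ) ≤ n * σ / 4 + 1)
    (hnσ : 6 ≤ n * σ) (hb : σ - 1 ≤ b) (hb' : b ≤ 1 / 2) :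
    ∃ k, k + m ≤ n ∧ ∀ j : ℕ, k ≤ j → j < k + m →
      b - σ ≤ -1 + (2 * (j : ℝ) + 1) / n ∧ -1 + (2 * (j : ℝ) + 1) / n ≤ b := by
  have hn : (0 : ℝ) < n := by
    rcases Nat.eq_zero_or_pos n with rfl | h
    · norm_num at hnσ
    · exact_mod_cast h
  set x := (b - σ + 1) * n / 2 with hx
  have hx0 : 0 ≤ x := div_nonneg (mul_nonneg (by linarith) hn.le) zero_le_two
  have hk := Nat.le_ceil x
  have hk' := Nat.ceil_lt_add_one hx0
  have hbn : b * n ≤ 1 / 2 * n := mul_le_mul_of_nonneg_right hb' hn.le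
  refine ⟨⌈x⌉₊, ?_, fun j hj hj' ↦ ?_⟩
  · have : ((⌈x⌉₊ + m : ℕ) : ℝ) ≤ n := by push_cast; nlinarith
    exact_mod_cast this
  · have hj1 : (⌈x⌉₊ : ℝ) ≤ j := by exact_mod_cast hj
    have hj2 : (j : ℝ) + 1 ≤ ⌈x⌉₊ + m := by exact_mod_cast hj'
    rw [← sub_le_iff_le_add', le_div_iff₀ hn, ← le_sub_iff_add_le', div_le_iff₀ hn]
    constructor <;> nlinarith

/-- The `m` consecutive indices starting at `k`. -/
def indexWindow (n m : ℕ) (k : Fin n) : Finset (Fin n) :=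
  {j | (k : ℕ) ≤ j ∧ (j : ℕ) < k + m}

theorem card_indexWindow {n m : ℕ} {k : Fin n} (h : (k : ℕ) + m ≤ n) :
    (indexWindow n m k).card = m := by
  rw [← Finset.card_map Fin.valEmbedding]
  have : (indexWindow n m k).map Fin.valEmbedding = Finset.Ico (k : ℕ) (k + m) := by
    ext j
    simp only [indexWindow, Finset.mem_map, Finset.mem_filter, Finset.mem_univ, true_and,
      Fin.valEmbedding_apply, Finset.mem_Ico]
    exact ⟨by rintro ⟨i, hi, rfl⟩; exact hi, fun hj ↦ ⟨⟨j, by omega⟩, hj, rfl⟩⟩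
  simp [this]

/-- The labels `y` deviate by at most `√(|W| L / 2)` from the means `p` on every window `W`. -/
def WindowConsistent {n : ℕ} (m : ℕ) (L : ℝ) (p : Fin n → ℝ) (y : Fin n → Bool) : Prop :=
  ∀ k, |∑ j ∈ indexWindow n m k, ((if y j then (1 : ℝ) else 0) - p j)| ≤
    √((indexWindow n m k).card * L / 2)

theorem bern_pi_not_windowConsistent_le {n : ℕ} (m : ℕ) {L : ℝ} (hL : 0 ≤ L) {p : Fin n → ℝ}
    (hp : ∀ i, p i ∈ Set.Icc (0 : ℝ) 1) :
    Measure.pi (fun i ↦ bern (p i)) {y | ¬ WindowConsistent m L p y} ≤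
      ENNReal.ofReal (n * (2 * exp (-L))) := by
  have : {y | ¬ WindowConsistent m L p y} = ⋃ k, {y | √((indexWindow n m k).card * L / 2) <
      |∑ j ∈ indexWindow n m k, ((if y j then (1 : ℝ) else 0) - p j)|} := by
    ext y
    simp [WindowConsistent]
  rw [this]
  refine (measure_iUnion_fintype_le _ _).trans
    ((Finset.sum_le_sum fun k _ ↦ bern_pi_sum_deviation_le hp (indexWindow n m k) hL).trans ?_)
  simp [ENNReal.ofReal_mul]

theorem WindowConsistent.gap_le {n m : ℕ} {L d : ℝ} {p q : Fin n → ℝ} {y : Fin n → Bool}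
    (hp : WindowConsistent m L p y) (hq : WindowConsistent m L q y) (k : Fin n)
    (hk : (k : ℕ) + m ≤ n) (hd : ∀ j ∈ indexWindow n m k, d ≤ p j - q j) :
    m * d ≤ 2 * √(m * L / 2) := by
  have h1 := (abs_le.1 (hp k)).1
  have h2 := (abs_le.1 (hq k)).2
  have h3 := Finset.card_nsmul_le_sum _ _ d hd
  simp only [Finset.sum_sub_distrib, nsmul_eq_mul, card_indexWindow hk] at h1 h2 h3
  linarith

/-- Two thresholds consistent with the same labels are closer than the bandwidth `h`. -/
theorem sub_lt_of_windowConsistent {n m : ℕ} {L σ c h a b : ℝ} {y : Fin n → Bool}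
    (hL : 0 < L) (hσ : σ ∈ Set.Ioc (0 : ℝ) (1 / 2)) (hc : 0 < c)
    (hm : n * σ / 4 ≤ m) (hm' : (m : ℝ) ≤ n * σ / 4 + 1) (hnσ : 6 ≤ n * σ) (hhσ : h ≤ σ)
    (hh : 0 ≤ h) (hh2 : 16 * σ * L ≤ c ^ 2 * h ^ 2 * n)
    (hb : b ∈ Set.Icc (-(1 : ℝ) / 2) (1 / 2))
    (ha : WindowConsistent m L
      (fun j : Fin n ↦ unifConv σ (stepFn c a) (-1 + (2 * (j : ℝ) + 1) / n)) y)
    (hb' : WindowConsistent m L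
      (fun j : Fin n ↦ unifConv σ (stepFn c b) (-1 + (2 * (j : ℝ) + 1) / n)) y) :
    b - a < h := by
  by_contra! hab
  have hm0 : (0 : ℝ) < m := by linarith
  have hm1 : 0 < m := by exact_mod_cast hm0
  obtain ⟨k, hkn, hk⟩ := exists_grid_window hm' hnσ
    (by linarith [hσ.2, hb.1] : σ - 1 ≤ b) hb.2
  have hgap := ha.gap_le hb' ⟨k, by omega⟩ hkn (d := c / σ * h) fun j hj ↦ by
    simp only [indexWindow, Finset.mem_filter, Finset.mem_univ, true_and] at hj
    obtain ⟨h1, h2⟩ := hk j hj.1 hj.2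
    exact unifConv_stepFn_gap hσ.1 hc.le hhσ hab h1 h2
  have hd : 0 ≤ c / σ * h := mul_nonneg (div_nonneg hc.le hσ.1.le) hh
  have hsq := pow_le_pow_left₀ (mul_nonneg hm0.le hd) hgap 2
  rw [mul_pow, mul_pow 2, sq_sqrt (by positivity)] at hsq
  have hmd : m * (c / σ * h) ^ 2 ≤ 2 * L := by nlinarith
  have hσd : c ^ 2 * h ^ 2 = σ ^ 2 * (c / σ * h) ^ 2 := by
    have := hσ.1
    field_simp
  have hσ0 := hσ.1
  have : n * σ / 4 * (c / σ * h) ^ 2 ≤ 2 * L :=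
    (mul_le_mul_of_nonneg_right hm (sq_nonneg _)).trans hmd
  rw [hσd] at hh2
  have : 16 * L ≤ n * σ * (c / σ * h) ^ 2 := by
    refine le_of_mul_le_mul_left ?_ hσ0
    linarith
  linarith

/-- Guarantee for the passive estimator WIDEHIST (`k = 1`): with
`h = κ √((σ/n) log(2n/δ)) ≤ σ`, there is an estimator `t̂` of the threshold from the
labels at the equally spaced design points `w_j = -1 + (2j-1)/n` such that
`P(|t̂ - t| > 2h) ≤ δ` for every `t ∈ [-1/2, 1/2]`. -/
theorem widehist_guarantee_k_one (c : ℝ) (hc : c ∈ Set.Ioc (0 : ℝ) (1 / 4)) :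
    ∃ κ : ℝ, 0 < κ ∧ ∃ n₀ : ℕ, 1 ≤ n₀ ∧
      ∀ n : ℕ, n₀ ≤ n → ∀ σ ∈ Set.Ioc (0 : ℝ) (1 / 2), ∀ δ ∈ Set.Ioo (0 : ℝ) 1,
        κ * Real.sqrt ((σ / n) * Real.log (2 * n / δ)) ≤ σ →
        ∃ that : (Fin n → Bool) → ℝ, Measurable that ∧
          ∀ t ∈ Set.Icc (-(1 : ℝ) / 2) (1 / 2),
            (Measure.pi fun j : Fin n =>
                bern (unifConv σ (stepFn c t) (-1 + (2 * (j : ℝ) + 1) / n)))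
              {y | |that y - t| > 2 * (κ * Real.sqrt ((σ / n) * Real.log (2 * n / δ)))} ≤
              ENNReal.ofReal δ := by
  have hc0 := hc.1
  refine ⟨4 / c, by positivity, 1, le_rfl, fun n hn σ hσ δ hδ hh ↦ ?_⟩
  have hσ0 := hσ.1
  have hn1 : (1 : ℝ) ≤ n := by exact_mod_cast hn
  have hδ0 := hδ.1
  set L := Real.log (2 * n / δ) with hLdef
  have hL2 : (1 / 2 : ℝ) < L := by
    have : Real.log 2 ≤ L := by
      refine Real.log_le_log two_pos ((le_div_iff₀ hδ0).2 ?_)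
      nlinarith [hδ.2]
    linarith [Real.log_two_gt_d9]
  have hL0 : 0 < L := by linarith
  set h := 4 / c * Real.sqrt (σ / n * L) with hhdef
  have hh0 : 0 < h := by positivity
  have hh2 : c ^ 2 * h ^ 2 * n = 16 * σ * L := by
    rw [hhdef, mul_pow, sq_sqrt (by positivity)]
    field_simp
    norm_num
  have hnσ : 6 ≤ n * σ := by
    have h1 : c ^ 2 * h ^ 2 * n ≤ (1 / 4) ^ 2 * σ ^ 2 * n := by
      gcongr
      exact hc.2
    have h2 : 16 * L ≤ (1 / 4) ^ 2 * (n * σ) := by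
      refine le_of_mul_le_mul_left ?_ hσ0
      linarith
    linarith
  set m := ⌈n * σ / 4⌉₊
  have hm : n * σ / 4 ≤ m := Nat.le_ceil _
  have hm' : (m : ℝ) ≤ n * σ / 4 + 1 := (Nat.ceil_lt_add_one (by positivity)).le
  set F : ℝ → Fin n → ℝ := fun s j ↦
    unifConv σ (stepFn c s) (-1 + (2 * (j : ℝ) + 1) / n) with hF
  classical
  refine ⟨fun y ↦ if hy : ∃ s ∈ Set.Icc (-(1 : ℝ) / 2) (1 / 2), WindowConsistent m L (F s) y
    then hy.choose else 0, measurable_of_finite _, fun t ht ↦ ?_⟩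
  calc _ ≤ Measure.pi (fun j ↦ bern (F t j)) {y | ¬ WindowConsistent m L (F t) y} := by
        refine measure_mono fun y hy hty ↦ ?_
        have hex : ∃ s ∈ Set.Icc (-(1 : ℝ) / 2) (1 / 2), WindowConsistent m L (F s) y :=
          ⟨t, ht, hty⟩
        simp only [Set.mem_ofPred_eq, dif_pos hex] at hy
        obtain ⟨hs, hsy⟩ := hex.choose_spec
        have h1 := sub_lt_of_windowConsistent hL0 hσ hc0 hm hm' hnσ hh hh0.le hh2.ge ht hsy hty
        have h2 := sub_lt_of_windowConsistent hL0 hσ hc0 hm hm' hnσ hh hh0.le hh2.ge hs hty hsy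
        have := abs_lt.2 ⟨by linarith, h2⟩
        linarith
    _ ≤ ENNReal.ofReal (n * (2 * exp (-L))) :=
        bern_pi_not_windowConsistent_le m hL0.le fun j ↦
          unifConv_stepFn_mem_Icc hσ0 hc0.le (by linarith [hc.2]) _ _
    _ = ENNReal.ofReal δ := by
        rw [hLdef, Real.exp_neg, Real.exp_log (by positivity)]
        congr 1
        field_simp
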